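/- arXiv:2009.00711 — 3 statements merged into one kernel-verified Lean document; each statement's English description precedes it below -/
import Mathlib

section
/- Let 0 < α ≤ √((π² − 1)/d). Then for all h ≥ 0, all z = u + iv ∈ ℂ^d with u ∈ [−π,π]^d and |v_p| ≤ α for each p, and all k ∈ ℤ^d with ‖k‖ ≥ √d, one has ‖u + 2πk‖ ≥ π(2‖k‖ − √d) > 0 and |q_h(z + 2πk)| ≥ ‖u + 2πk‖² − ‖v‖² + h² ≥ π²(2‖k‖ − √d)² + 1 − π². -/
open MeasureTheory Real Filter
open scoped BigOperators

noncomputable section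

/-- `q_h(z) = z₁² + ⋯ + z_d² + h²` for `z ∈ ℂ^d` (squares of the entries). -/
def qC (d : ℕ) (h : ℝ) (z : Fin d → ℂ) : ℂ := (∑ p, (z p) ^ 2) + (h : ℂ) ^ 2

/-- The Euclidean norm of an integer vector `k ∈ ℤ^d`. -/
def normZ (d : ℕ) (k : Fin d → ℤ) : ℝ := Real.sqrt (∑ p, ((k p : ℝ)) ^ 2)

/-- A Euclidean reverse triangle inequality in squared form. -/
lemma sq_sub_le_sum_add_sq {ι : Type*} [Fintype ι] {a b : ι → ℝ} {A : ℝ}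
    (hA : Real.sqrt (∑ i, a i ^ 2) ≤ A) (hAb : A ≤ Real.sqrt (∑ i, b i ^ 2)) :
    (Real.sqrt (∑ i, b i ^ 2) - A) ^ 2 ≤ ∑ i, (a i + b i) ^ 2 := by
  have hcs := Real.sum_mul_le_sqrt_mul_sqrt Finset.univ (fun i => -a i) b
  simp only [neg_sq, neg_mul, Finset.sum_neg_distrib] at hcs
  have ha := Real.sq_sqrt (Finset.sum_nonneg fun i (_ : i ∈ Finset.univ) => sq_nonneg (a i))
  have hb := Real.sq_sqrt (Finset.sum_nonneg fun i (_ : i ∈ Finset.univ) => sq_nonneg (b i))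
  have hexp : ∑ i, (a i + b i) ^ 2 = ∑ i, a i ^ 2 + 2 * ∑ i, a i * b i + ∑ i, b i ^ 2 := by
    simp only [add_sq, Finset.sum_add_distrib, Finset.mul_sum, mul_assoc]
  rw [hexp]
  nlinarith

lemma sum_sq_le_card_mul_sq {ι : Type*} [Fintype ι] {a : ι → ℝ} {c : ℝ}
    (h : ∀ i, |a i| ≤ c) : ∑ i, a i ^ 2 ≤ Fintype.card ι * c ^ 2 := by
  have := Finset.sum_le_card_nsmul Finset.univ (fun i => a i ^ 2) (c ^ 2)
    fun i _ => sq_le_sq' (abs_le.mp (h i)).1 (abs_le.mp (h i)).2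
  simpa using this

lemma re_qC (d : ℕ) (h : ℝ) (z : Fin d → ℂ) :
    (qC d h z).re = ∑ p, (z p).re ^ 2 - ∑ p, (z p).im ^ 2 + h ^ 2 := by
  simp [qC, pow_two, Finset.sum_sub_distrib]

/-- For `0 < α ≤ √((π²-1)/d)`, all `h ≥ 0`, all `z = u + iv` with `u ∈ [-π,π]^d` and
`|v_p| ≤ α`, and all `k ∈ ℤ^d` with `‖k‖ ≥ √d`:
`‖u+2πk‖ ≥ π(2‖k‖ - √d) > 0` and
`|q_h(z+2πk)| ≥ ‖u+2πk‖² - ‖v‖² + h² ≥ π²(2‖k‖-√d)² + 1 - π²`. -/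
theorem stmt_8 (d : ℕ) (hd : 1 ≤ d) (α : ℝ) (hα : 0 < α)
    (hα' : α ≤ Real.sqrt ((π ^ 2 - 1) / d))
    (h : ℝ) (hh : 0 ≤ h) (z : Fin d → ℂ)
    (hu : ∀ p, |(z p).re| ≤ π) (hv : ∀ p, |(z p).im| ≤ α)
    (k : Fin d → ℤ) (hk : Real.sqrt d ≤ normZ d k) :
    0 < π * (2 * normZ d k - Real.sqrt d) ∧
    π * (2 * normZ d k - Real.sqrt d) ≤
        Real.sqrt (∑ p, ((z p).re + 2 * π * (k p : ℝ)) ^ 2) ∧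
    (∑ p, ((z p).re + 2 * π * (k p : ℝ)) ^ 2) - (∑ p, ((z p).im) ^ 2) + h ^ 2 ≤
        ‖qC d h (fun p => z p + 2 * (π : ℂ) * (k p : ℂ))‖ ∧
    π ^ 2 * (2 * normZ d k - Real.sqrt d) ^ 2 + 1 - π ^ 2 ≤
        (∑ p, ((z p).re + 2 * π * (k p : ℝ)) ^ 2) - (∑ p, ((z p).im) ^ 2) + h ^ 2 := by
  have hd0 : (0 : ℝ) < d := by exact_mod_cast hd
  have hsd : 0 < Real.sqrt d := Real.sqrt_pos.mpr hd0
  have hπ : 0 < π := Real.pi_pos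
  have hpos : 0 < π * (2 * normZ d k - Real.sqrt d) := mul_pos hπ (by linarith)
  have hU : Real.sqrt (∑ p, (z p).re ^ 2) ≤ π * Real.sqrt d := by
    refine Real.sqrt_le_iff.mpr ⟨by positivity, ?_⟩
    have := sum_sq_le_card_mul_sq hu
    rw [Fintype.card_fin] at this
    rw [mul_pow, Real.sq_sqrt hd0.le]
    linarith
  have hK : Real.sqrt (∑ p, (2 * π * (k p : ℝ)) ^ 2) = 2 * π * normZ d k := by
    simp only [mul_pow _ (Int.cast _ : ℝ), ← Finset.mul_sum]
    rw [Real.sqrt_mul (by positivity), Real.sqrt_sq (by positivity), normZ]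
  have hS : (π * (2 * normZ d k - Real.sqrt d)) ^ 2 ≤
      ∑ p, ((z p).re + 2 * π * (k p : ℝ)) ^ 2 := by
    have := sq_sub_le_sum_add_sq hU (b := fun p => 2 * π * (k p : ℝ))
      (by rw [hK]; nlinarith)
    rw [hK] at this
    convert this using 1
    ring
  have hV : ∑ p, (z p).im ^ 2 ≤ π ^ 2 - 1 := by
    have hπ1 : 0 ≤ (π ^ 2 - 1) / d :=
      div_nonneg (by nlinarith [Real.pi_gt_three]) hd0.le
    have h1 := sum_sq_le_card_mul_sq fun p => (hv p).trans hα'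
    rwa [Fintype.card_fin, Real.sq_sqrt hπ1, mul_div_cancel₀ _ hd0.ne'] at h1
  refine ⟨hpos, Real.le_sqrt_of_sq_le hS, ?_, ?_⟩
  · refine le_trans (le_of_eq ?_) (Complex.re_le_norm _)
    simp [re_qC]
  · rw [mul_pow] at hS
    nlinarith [sq_nonneg h]
end
end

section
/- Let m be a positive integer with 2m > d. Then there exists α > 0 (with α ≤ √((π² − 1)/d)) such that for all h ∈ [0,1] and all z = u + iv ∈ ℂ^d with u ∈ [−π,π]^d and |v_p| ≤ α for each p, one has 1 + q_h(z)^m G_{m,h}(z) ≠ 0, where G_{m,h}(z) := Σ_{k∈ℤ^d, k≠0} q_h(z + 2πk)^{−m}. -/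
open MeasureTheory Real Filter
open scoped BigOperators

noncomputable section

/-- The inverse powers of the sup norm are summable over `ℤ^d` when the exponent exceeds `d`. -/
lemma summable_norm_intCast_inv_pow (d n : ℕ) (hn : d < n) :
    Summable fun k : Fin d → ℤ ↦ ‖fun p ↦ (k p : ℝ)‖⁻¹ ^ n := by
  let L : Submodule ℤ (Fin d → ℝ) := Submodule.span ℤ (Set.range (Pi.basisFun ℝ (Fin d)))
  have hrank : Module.finrank ℤ L = d := by
    rw [ZLattice.rank ℝ L, Module.finrank_fin_fun]
  have hmem (k : Fin d → ℤ) : (fun p ↦ (k p : ℝ)) ∈ L := by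
    rw [(Pi.basisFun ℝ (Fin d)).mem_span_iff_repr_mem ℤ]
    exact fun i ↦ ⟨k i, by simp⟩
  refine (ZLattice.summable_norm_pow_inv L n (by rwa [hrank])).comp_injective
    (i := fun k ↦ (⟨_, hmem k⟩ : L)) fun k l hkl ↦ ?_
  ext p
  simpa using congrFun (congrArg Subtype.val hkl) p

lemma qC_re (d : ℕ) (h : ℝ) (z : Fin d → ℂ) :
    (qC d h z).re = ∑ p, ((z p).re ^ 2 - (z p).im ^ 2) + h ^ 2 := by
  simp [qC, pow_two]

lemma qC_ofReal (d : ℕ) (h : ℝ) (u : Fin d → ℝ) :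
    qC d h (fun p ↦ (u p : ℂ)) = ((∑ p, u p ^ 2 + h ^ 2 : ℝ) : ℂ) := by
  simp [qC]

lemma continuous_qC (d : ℕ) : Continuous fun x : ℝ × (Fin d → ℂ) ↦ qC d x.1 x.2 := by
  unfold qC
  fun_prop

lemma pi_sq_mul_sq_le_add_two_pi_mul_sq {u : ℝ} (hu : |u| ≤ π) (k : ℤ) :
    π ^ 2 * (k : ℝ) ^ 2 ≤ (u + 2 * π * k) ^ 2 := by
  rcases eq_or_ne k 0 with rfl | hk
  · simpa using sq_nonneg u
  have h1 : (1 : ℝ) ≤ |(k : ℝ)| := mod_cast Int.one_le_abs hk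
  rw [← mul_pow, sq_le_sq]
  have h2 : |2 * π * k| ≤ |u + 2 * π * k| + |u| := by
    simpa using abs_sub (u + 2 * π * k) u
  rw [abs_mul, abs_of_pos (by positivity : 0 < 2 * π)] at h2
  rw [abs_mul, abs_of_pos pi_pos]
  nlinarith [pi_pos]

/-- On the tube around the cube, translates of `q_h` by nonzero periods are bounded below. -/
lemma norm_sq_le_norm_qC_translate {d : ℕ} {α : ℝ} (hα : d * α ^ 2 ≤ π ^ 2 - 1) (h : ℝ)
    {z : Fin d → ℂ} (hre : ∀ p, |(z p).re| ≤ π) (him : ∀ p, |(z p).im| ≤ α)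
    {k : Fin d → ℤ} (hk : k ≠ 0) :
    ‖fun p ↦ (k p : ℝ)‖ ^ 2 ≤ ‖qC d h (fun p ↦ z p + 2 * (π : ℂ) * (k p : ℂ))‖ := by
  refine le_trans ?_ (Complex.re_le_norm _)
  have hre' (p) : (z p + 2 * (π : ℂ) * (k p : ℂ)).re = (z p).re + 2 * π * k p := by simp
  have him' (p) : (z p + 2 * (π : ℂ) * (k p : ℂ)).im = (z p).im := by simp
  rw [qC_re]
  simp only [hre', him', Finset.sum_sub_distrib]
  have h1 : π ^ 2 * ∑ p, (k p : ℝ) ^ 2 ≤ ∑ p, ((z p).re + 2 * π * k p) ^ 2 := by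
    rw [Finset.mul_sum]
    exact Finset.sum_le_sum fun p _ ↦ pi_sq_mul_sq_le_add_two_pi_mul_sq (hre p) (k p)
  have h2 : ∑ p, (z p).im ^ 2 ≤ d * α ^ 2 := by
    refine (Finset.sum_le_sum fun p _ ↦ sq_le_sq.2 ((him p).trans (le_abs_self α))).trans ?_
    simp
  obtain ⟨p, hp⟩ := Function.ne_iff.1 hk
  have hle (p) : (k p : ℝ) ^ 2 ≤ ∑ p, (k p : ℝ) ^ 2 :=
    Finset.single_le_sum (f := fun p ↦ (k p : ℝ) ^ 2) (fun _ _ ↦ sq_nonneg _) (Finset.mem_univ p)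
  have h3 : 1 ≤ ∑ p, (k p : ℝ) ^ 2 := by
    refine le_trans ?_ (hle p)
    rw [one_le_sq_iff_one_le_abs]
    exact_mod_cast Int.one_le_abs hp
  have h4 : ‖fun p ↦ (k p : ℝ)‖ ^ 2 ≤ ∑ p, (k p : ℝ) ^ 2 := by
    refine (Real.le_sqrt (norm_nonneg _) (by linarith)).1 ?_
    refine (pi_norm_le_iff_of_nonneg (Real.sqrt_nonneg _)).2 fun p ↦ ?_
    exact Real.le_sqrt_of_sq_le (by simpa using hle p)
  have hπ : 0 ≤ π ^ 2 - 1 := by nlinarith [pi_gt_three]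
  linarith [mul_nonneg hπ (sub_nonneg.2 h3), sq_nonneg h]

/-- The set of `z = u + iv` with `u ∈ [-π,π]^d` and `|v_p| ≤ α` for each `p`. -/
def tube (d : ℕ) (α : ℝ) : Set (Fin d → ℂ) :=
  {z | (∀ p, |(z p).re| ≤ π) ∧ ∀ p, |(z p).im| ≤ α}

lemma isCompact_tube (d : ℕ) (α : ℝ) : IsCompact (tube d α) := by
  convert isCompact_univ_pi fun _ : Fin d ↦
    (isCompact_Icc (a := -π) (b := π)).reProdIm (isCompact_Icc (a := -α) (b := α)) using 1
  ext z
  simp [tube, Complex.mem_reProdIm, abs_le, forall_and]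

/-- `1 + q_h(z)^m G_{m,h}(z)`. -/
def oneAddMulG (d m : ℕ) (h : ℝ) (z : Fin d → ℂ) : ℂ :=
  1 + (qC d h z) ^ m * ∑' k : {k : Fin d → ℤ // k ≠ 0},
    ((qC d h (fun p => z p + 2 * (π : ℂ) * (k.1 p : ℂ))) ^ m)⁻¹

lemma continuousOn_oneAddMulG {d m : ℕ} (hm : d < 2 * m) {α : ℝ}
    (hα : d * α ^ 2 ≤ π ^ 2 - 1) :
    ContinuousOn (fun x : ℝ × (Fin d → ℂ) ↦ oneAddMulG d m x.1 x.2)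
      (Set.univ ×ˢ tube d α) := by
  refine continuousOn_const.add (((continuous_qC d).pow m).continuousOn.mul ?_)
  have hpos (k : {k : Fin d → ℤ // k ≠ 0}) : 0 < ‖fun p ↦ (k.1 p : ℝ)‖ := by
    refine norm_pos_iff.2 fun h ↦ k.2 (funext fun p ↦ ?_)
    simpa using congrFun h p
  refine continuousOn_tsum (fun k ↦ ContinuousOn.inv₀ ?_ ?_)
    ((summable_norm_intCast_inv_pow d (2 * m) hm).comp_injective Subtype.val_injective) ?_
  · refine (Continuous.pow ?_ m).continuousOn
    exact (continuous_qC d).comp (f := fun x : ℝ × (Fin d → ℂ) ↦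
      (x.1, fun p ↦ x.2 p + 2 * (π : ℂ) * (k.1 p : ℂ))) (by fun_prop)
  · intro x hx
    refine pow_ne_zero _ (norm_pos_iff.1 (lt_of_lt_of_le ?_
      (norm_sq_le_norm_qC_translate hα x.1 hx.2.1 hx.2.2 k.2)))
    exact pow_pos (hpos k) 2
  · intro k x hx
    rw [norm_inv, norm_pow, Function.comp_apply, inv_pow, pow_mul]
    refine inv_anti₀ (pow_pos (pow_pos (hpos k) 2) m) ?_
    exact pow_le_pow_left₀ (by positivity)
      (norm_sq_le_norm_qC_translate hα x.1 hx.2.1 hx.2.2 k.2) m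

lemma oneAddMulG_ofReal_ne_zero (d m : ℕ) (h : ℝ) (u : Fin d → ℝ) :
    oneAddMulG d m h (fun p ↦ (u p : ℂ)) ≠ 0 := by
  have hk (k : Fin d → ℤ) : (fun p ↦ (u p : ℂ) + 2 * (π : ℂ) * (k p : ℂ)) =
      fun p ↦ ((u p + 2 * π * k p : ℝ) : ℂ) := by
    ext p
    push_cast
    rfl
  simp only [oneAddMulG, hk, qC_ofReal, ← Complex.ofReal_pow, ← Complex.ofReal_inv,
    ← Complex.ofReal_tsum, ← Complex.ofReal_mul, ← Complex.ofReal_one, ← Complex.ofReal_add]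
  refine Complex.ofReal_ne_zero.2 (ne_of_gt (add_pos_of_pos_of_nonneg one_pos ?_))
  exact mul_nonneg (by positivity) (tsum_nonneg fun k ↦ by positivity)


/-- Let `2m > d`. There exists `α > 0` (with `α ≤ √((π²-1)/d)`) such that for all
`h ∈ [0,1]` and all `z = u+iv` with `u ∈ [-π,π]^d` and `|v_p| ≤ α` for each `p`,
`1 + q_h(z)^m G_{m,h}(z) ≠ 0`, where `G_{m,h}(z) = Σ_{k≠0} q_h(z+2πk)^{-m}`. -/
theorem stmt_10 (d m : ℕ) (hd : 1 ≤ d) (hm : d < 2 * m) :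
    ∃ α : ℝ, 0 < α ∧ α ≤ Real.sqrt ((π ^ 2 - 1) / d) ∧
      ∀ h ∈ Set.Icc (0 : ℝ) 1, ∀ z : Fin d → ℂ,
        (∀ p, |(z p).re| ≤ π) → (∀ p, |(z p).im| ≤ α) →
        1 + (qC d h z) ^ m *
          ∑' k : {k : Fin d → ℤ // k ≠ 0},
            ((qC d h (fun p => z p + 2 * (π : ℂ) * (k.1 p : ℂ))) ^ m)⁻¹ ≠ 0 := by
  have hd' : (0 : ℝ) < d := by exact_mod_cast hd
  have hπ : 0 < (π ^ 2 - 1) / d := div_pos (by nlinarith [pi_gt_three]) hd'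
  set a := √((π ^ 2 - 1) / d) with ha
  have ha0 : 0 < a := Real.sqrt_pos.2 hπ
  have haα : d * a ^ 2 ≤ π ^ 2 - 1 := by
    rw [ha, Real.sq_sqrt hπ.le, mul_div_cancel₀ _ hd'.ne']
  let K : Set (ℝ × (Fin d → ℂ)) := Set.Icc 0 1 ×ˢ tube d a
  have hK : IsCompact K := isCompact_Icc.prod (isCompact_tube d a)
  have hF : ContinuousOn (fun x : ℝ × (Fin d → ℂ) ↦ oneAddMulG d m x.1 x.2) K :=
    (continuousOn_oneAddMulG hm haα).mono (Set.prod_mono_left (Set.subset_univ _))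
  let Z := K ∩ (fun x : ℝ × (Fin d → ℂ) ↦ oneAddMulG d m x.1 x.2) ⁻¹' {0}
  have hZ : IsCompact Z :=
    hK.of_isClosed_subset (hF.preimage_isClosed_of_isClosed hK.isClosed isClosed_singleton)
      Set.inter_subset_left
  rcases Z.eq_empty_or_nonempty with hZe | hZne
  · refine ⟨a, ha0, le_rfl, fun h hh z hre him h0 ↦ ?_⟩
    exact Set.notMem_empty (h, z) (hZe ▸ ⟨⟨hh, hre, him⟩, h0⟩)
  obtain ⟨x, hx, hmin⟩ := hZ.exists_isMinOn hZne
    (f := fun x : ℝ × (Fin d → ℂ) ↦ ‖fun p ↦ (x.2 p).im‖) (by fun_prop)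
  have hpos : 0 < ‖fun p ↦ (x.2 p).im‖ := by
    refine norm_pos_iff.2 fun him ↦ oneAddMulG_ofReal_ne_zero d m x.1 (fun p ↦ (x.2 p).re) ?_
    have hreal : (fun p ↦ ((x.2 p).re : ℂ)) = x.2 := by
      ext p
      exact Complex.ext (by simp) (by simpa using (congrFun him p).symm)
    rw [hreal]
    exact hx.2
  refine ⟨min a (‖fun p ↦ (x.2 p).im‖ / 2), lt_min ha0 (half_pos hpos), min_le_left _ _,
    fun h hh z hre him h0 ↦ ?_⟩
  have h1 := isMinOn_iff.1 hmin (h, z) ⟨⟨hh, hre, fun p ↦ (him p).trans (min_le_left _ _)⟩, h0⟩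
  have h2 : ‖fun p ↦ (z p).im‖ ≤ ‖fun p ↦ (x.2 p).im‖ / 2 :=
    (pi_norm_le_iff_of_nonneg (half_pos hpos).le).2 fun p ↦ (him p).trans (min_le_right _ _)
  dsimp only at h1
  linarith
end
end

section
/- Let m be a positive integer with 2m > d. There exists α > 0, depending only on d and m, such that for every B ∈ (0,α) there is a constant C > 0 with the following property: for every h ∈ [0,1] and every γ ∈ {−B, B}^d, for almost every t ∈ ℝ^d the series S_h(t + iγ) := Σ_{k∈ℤ^d} q_h(t + iγ + 2πk)^{−m} converges absolutely with S_h(t + iγ) ≠ 0, and ∫_{ℝ^d} |S_h(t + iγ)|^{−1} |q_h(t + iγ)|^{−m} dt ≤ C. -/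
open MeasureTheory Real Filter
open scoped BigOperators

noncomputable section

lemma summable_norm_inv_pow_intVec {d n : ℕ} (hn : d < n) :
    Summable fun k : Fin d → ℤ => ‖k‖⁻¹ ^ n := by
  let L := Submodule.span ℤ (Set.range (Pi.basisFun ℝ (Fin d)))
  have hrank : Module.finrank ℤ L < n := by
    rw [ZLattice.rank ℝ L]
    simpa using hn
  have hmem : ∀ k : Fin d → ℤ, (fun p => (k p : ℝ)) ∈ L := fun k => by
    rw [(Pi.basisFun ℝ (Fin d)).mem_span_iff_repr_mem ℤ]
    exact fun p => ⟨k p, by simp⟩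
  let f : (Fin d → ℤ) → L := fun k => ⟨fun p => (k p : ℝ), hmem k⟩
  have hf : Function.Injective f := fun a b hab => by
    funext p
    have := congrFun (congrArg Subtype.val hab) p
    simpa [f] using this
  refine ((ZLattice.summable_norm_pow_inv L n hrank).comp_injective hf).congr fun k => ?_
  have h : ‖f k‖ = ‖k‖ := by
    change ‖fun p => (k p : ℝ)‖ = ‖k‖
    rw [Pi.norm_def, Pi.norm_def]
    congr 2
  simp only [Function.comp_apply, h]

lemma norm_pow_sub_pow_le_of_norm_le {a b : ℂ} {R B : ℝ} (ha : ‖a‖ ≤ R) (hb : ‖b‖ ≤ R)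
    (hab : ‖a - b‖ ≤ B * R) (n : ℕ) : ‖a ^ n - b ^ n‖ ≤ n * B * R ^ n := by
  induction n with
  | zero => simp
  | succ n ih =>
    have hR : 0 ≤ R := (norm_nonneg a).trans ha
    have h : a ^ (n + 1) - b ^ (n + 1) = a * (a ^ n - b ^ n) + (a - b) * b ^ n := by ring
    calc ‖a ^ (n + 1) - b ^ (n + 1)‖
        ≤ ‖a‖ * ‖a ^ n - b ^ n‖ + ‖a - b‖ * ‖b‖ ^ n := by
          rw [h, ← norm_pow, ← norm_mul, ← norm_mul]
          exact norm_add_le _ _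
      _ ≤ R * (n * B * R ^ n) + B * R * R ^ n := by
          gcongr
          exact (norm_nonneg _).trans hab
      _ = (n + 1 : ℕ) * B * R ^ (n + 1) := by push_cast; ring

/-- The point `x + iγ` of `ℂ^d`. -/
def complexPoint {d : ℕ} (x γ : Fin d → ℝ) : Fin d → ℂ :=
  fun p => (x p : ℂ) + Complex.I * (γ p : ℂ)

/-- The translate `t + 2πk`. -/
def latticeShift {d : ℕ} (t : Fin d → ℝ) (k : Fin d → ℤ) : Fin d → ℝ :=
  fun p => t p + 2 * π * k p

lemma latticeShift_zero {d : ℕ} (t : Fin d → ℝ) : latticeShift t 0 = t := by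
  funext p; simp [latticeShift]

lemma latticeShift_latticeShift {d : ℕ} (t : Fin d → ℝ) (k l : Fin d → ℤ) :
    latticeShift (latticeShift t k) l = latticeShift t (k + l) := by
  funext p; simp only [latticeShift, Pi.add_apply]; push_cast; ring

lemma complexPoint_latticeShift {d : ℕ} (t γ : Fin d → ℝ) (k : Fin d → ℤ) :
    complexPoint (latticeShift t k) γ =
      fun p => (t p : ℂ) + Complex.I * (γ p : ℂ) + 2 * (π : ℂ) * (k p : ℂ) := by
  funext p; simp only [complexPoint, latticeShift]; push_cast; ring

lemma norm_le_norm_latticeShift {d : ℕ} {t : Fin d → ℝ} (ht : ‖t‖ ≤ π) {k : Fin d → ℤ}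
    (hk : k ≠ 0) : 1 ≤ ‖k‖ ∧ ‖k‖ ≤ ‖latticeShift t k‖ := by
  obtain ⟨p₀, hp₀⟩ := Function.ne_iff.1 hk
  have h1 : 1 ≤ ‖k‖ := by
    refine le_trans ?_ (norm_le_pi_norm k p₀)
    rw [Int.norm_eq_abs]
    exact_mod_cast Int.one_le_abs hp₀
  refine ⟨h1, ?_⟩
  refine (pi_norm_le_iff_of_nonneg (norm_nonneg _)).2 fun p => ?_
  by_cases hp : k p = 0
  · simp [hp]
  refine le_trans ?_ (norm_le_pi_norm (latticeShift t k) p)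
  have htp : |t p| ≤ π := (norm_le_pi_norm t p).trans ht
  have hkp : (1 : ℝ) ≤ |(k p : ℝ)| := by exact_mod_cast Int.one_le_abs hp
  have h2 : |2 * π * (k p : ℝ)| ≤ |t p + 2 * π * k p| + |t p| := by
    have := abs_sub (t p + 2 * π * k p) (t p)
    simpa using this
  rw [abs_mul, abs_of_pos (by positivity : 0 < 2 * π)] at h2
  rw [Int.norm_eq_abs, Real.norm_eq_abs]
  simp only [latticeShift]
  nlinarith [pi_gt_three]

lemma exists_latticeShift_norm_le {d : ℕ} (t : Fin d → ℝ) :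
    ∃ n : Fin d → ℤ, ‖latticeShift t n‖ ≤ π := by
  refine ⟨fun p => -round (t p / (2 * π)), (pi_norm_le_iff_of_nonneg pi_pos.le).2 fun p => ?_⟩
  have h := abs_sub_round (t p / (2 * π))
  have h2 : latticeShift t (fun p => -round (t p / (2 * π))) p
      = 2 * π * (t p / (2 * π) - round (t p / (2 * π))) := by
    simp only [latticeShift]
    field_simp
    push_cast
    ring
  rw [h2, Real.norm_eq_abs, abs_mul, abs_of_pos (by positivity : 0 < 2 * π)]
  nlinarith [pi_pos]

/-- The value of `q_h` at the real point `x`. -/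
def qReal {d : ℕ} (h : ℝ) (x : Fin d → ℝ) : ℝ := ∑ p, x p ^ 2 + h ^ 2

lemma qReal_nonneg {d : ℕ} (h : ℝ) (x : Fin d → ℝ) : 0 ≤ qReal h x := by
  unfold qReal; positivity

lemma sq_norm_le_qReal {d : ℕ} (h : ℝ) (x : Fin d → ℝ) :
    ‖x‖ ^ 2 ≤ qReal h x := by
  rw [← Real.le_sqrt (norm_nonneg x) (qReal_nonneg h x)]
  refine (pi_norm_le_iff_of_nonneg (Real.sqrt_nonneg _)).2 fun p => Real.abs_le_sqrt ?_
  have := Finset.single_le_sum (f := fun p => x p ^ 2) (fun i _ => sq_nonneg _)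
    (Finset.mem_univ p)
  unfold qReal
  nlinarith [sq_nonneg h]

lemma qReal_le {d : ℕ} {h : ℝ} (hh : h ∈ Set.Icc (0 : ℝ) 1) (x : Fin d → ℝ) :
    qReal h x ≤ d * ‖x‖ ^ 2 + 1 := by
  have h1 : ∑ p, x p ^ 2 ≤ ∑ _p : Fin d, ‖x‖ ^ 2 := Finset.sum_le_sum fun p _ => by
    rw [← sq_abs]
    exact pow_le_pow_left₀ (abs_nonneg _) (norm_le_pi_norm x p) 2
  simp only [Finset.sum_const, Finset.card_univ, Fintype.card_fin, nsmul_eq_mul] at h1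
  unfold qReal
  nlinarith [hh.1, hh.2]

lemma norm_qC_sub_qReal_le {d : ℕ} {h B : ℝ} {γ : Fin d → ℝ} (hB1 : B ≤ 1)
    (hγ : ∀ p, |γ p| ≤ B) (x : Fin d → ℝ) :
    ‖qC d h (complexPoint x γ) - qReal h x‖ ≤ d * B * (1 + 2 * ‖x‖) := by
  have h1 : qC d h (complexPoint x γ) - qReal h x =
      ∑ p, (2 * Complex.I * x p * γ p - (γ p : ℂ) ^ 2) := by
    simp only [qC, complexPoint, qReal]
    push_cast
    rw [add_sub_add_right_eq_sub, ← Finset.sum_sub_distrib]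
    refine Finset.sum_congr rfl fun p _ => ?_
    linear_combination (γ p : ℂ) ^ 2 * Complex.I_sq
  rw [h1]
  refine (norm_sum_le _ _).trans ?_
  have h2 : ∀ p ∈ Finset.univ, ‖2 * Complex.I * x p * γ p - (γ p : ℂ) ^ 2‖
      ≤ B * (1 + 2 * ‖x‖) := fun p _ => by
    refine (norm_sub_le _ _).trans ?_
    simp only [norm_mul, norm_pow, Complex.norm_I, Complex.norm_real, Complex.norm_ofNat,
      Real.norm_eq_abs]
    have hx : |x p| ≤ ‖x‖ := norm_le_pi_norm x p
    have h3 : |x p| * |γ p| ≤ ‖x‖ * B :=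
      mul_le_mul hx (hγ p) (abs_nonneg _) (norm_nonneg _)
    nlinarith [hγ p, abs_nonneg (γ p)]
  refine (Finset.sum_le_sum h2).trans (le_of_eq ?_)
  simp
  ring

lemma half_sq_norm_le_norm_qC {d : ℕ} {h B : ℝ} {γ : Fin d → ℝ} (hd : 1 ≤ d) (hB1 : B ≤ 1)
    (hB : 6 * d * B ≤ 1) (hγ : ∀ p, |γ p| ≤ B) {x : Fin d → ℝ} (hx : 1 ≤ ‖x‖) :
    ‖x‖ ^ 2 / 2 ≤ ‖qC d h (complexPoint x γ)‖ := by
  have h1 := norm_qC_sub_qReal_le (h := h) hB1 hγ x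
  have h2 := sq_norm_le_qReal h x
  have h3 : qReal h x ≤ ‖qC d h (complexPoint x γ)‖ +
      ‖qC d h (complexPoint x γ) - qReal h x‖ := by
    have := norm_sub_le (qC d h (complexPoint x γ)) (qC d h (complexPoint x γ) - qReal h x)
    rwa [sub_sub_cancel, Complex.norm_real, Real.norm_of_nonneg (qReal_nonneg h x)] at this
  have hB0 : 0 ≤ B := (abs_nonneg _).trans (hγ ⟨0, hd⟩)
  have h4 : d * B * (1 + 2 * ‖x‖) ≤ d * B * (3 * ‖x‖ ^ 2) := by
    gcongr
    nlinarith
  nlinarith [sq_nonneg ‖x‖]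

/-- A bound for `|q_h|` near the fundamental cell `[-π, π]^d`. -/
def cellBound (d : ℕ) : ℝ := d * π ^ 2 + 1 + d * (1 + 2 * π)

lemma one_le_cellBound (d : ℕ) : 1 ≤ cellBound d := by
  have : 0 ≤ (d : ℝ) * π ^ 2 + d * (1 + 2 * π) := by positivity
  unfold cellBound
  linarith

lemma qReal_le_cellBound {d : ℕ} {h : ℝ} (hh : h ∈ Set.Icc (0 : ℝ) 1) {t : Fin d → ℝ}
    (ht : ‖t‖ ≤ π) : qReal h t ≤ d * π ^ 2 + 1 :=
  (qReal_le hh t).trans (by gcongr)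

lemma norm_qC_le_cellBound {d : ℕ} {h B : ℝ} {γ : Fin d → ℝ} (hh : h ∈ Set.Icc (0 : ℝ) 1)
    (hB1 : B ≤ 1) (hγ : ∀ p, |γ p| ≤ B) {t : Fin d → ℝ} (ht : ‖t‖ ≤ π) :
    ‖qC d h (complexPoint t γ)‖ ≤ cellBound d := by
  have h1 := norm_qC_sub_qReal_le (h := h) hB1 hγ t
  have h2 := qReal_le_cellBound hh ht
  have h3 := norm_le_norm_add_norm_sub' (qC d h (complexPoint t γ)) (qReal h t : ℂ)
  rw [Complex.norm_real, Real.norm_of_nonneg (qReal_nonneg h t)] at h3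
  have h4 : d * B * (1 + 2 * ‖t‖) ≤ d * 1 * (1 + 2 * π) := by gcongr
  unfold cellBound
  linarith

/-- Comparison of the complex and the real ratios `q_h(z) / q_h(z + 2πk)`. -/
lemma ratio_bounds {d : ℕ} {h B : ℝ} {γ : Fin d → ℝ} (hd : 1 ≤ d)
    (hh : h ∈ Set.Icc (0 : ℝ) 1) (hB0 : 0 ≤ B) (hB1 : B ≤ 1) (hB : 6 * d * B ≤ 1)
    (hγ : ∀ p, |γ p| ≤ B) {t x : Fin d → ℝ} {r : ℝ} (ht : ‖t‖ ≤ π) (hr : 1 ≤ r)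
    (hx : r ≤ ‖x‖) :
    ‖qC d h (complexPoint t γ) / qC d h (complexPoint x γ)‖ ≤ 8 * d * cellBound d * r⁻¹ ^ 2 ∧
    ‖(qReal h t : ℂ) / qReal h x‖ ≤ 8 * d * cellBound d * r⁻¹ ^ 2 ∧
    ‖qC d h (complexPoint t γ) / qC d h (complexPoint x γ) - (qReal h t : ℂ) / qReal h x‖ ≤
      B * (8 * d * cellBound d * r⁻¹ ^ 2) := by
  set M := cellBound d with hM
  have hM1 : 1 ≤ M := one_le_cellBound d
  have hd1 : (1 : ℝ) ≤ d := by exact_mod_cast hd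
  have hx1 : 1 ≤ ‖x‖ := hr.trans hx
  have hqt : ‖qC d h (complexPoint t γ)‖ ≤ M := norm_qC_le_cellBound hh hB1 hγ ht
  have hqx := half_sq_norm_le_norm_qC (h := h) hd hB1 hB hγ hx1
  have hrx : r ^ 2 ≤ ‖x‖ ^ 2 := by gcongr
  have hr2 : 0 < r ^ 2 := by positivity
  have hNx := sq_norm_le_qReal h x
  have hNt : qReal h t ≤ M := by
    have := qReal_le_cellBound hh ht
    have h0 : 0 ≤ d * (1 + 2 * π) := by positivity
    rw [hM, cellBound]; linarith
  have hNt0 := qReal_nonneg h t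
  have hδt := norm_qC_sub_qReal_le (h := h) hB1 hγ t
  have hδx := norm_qC_sub_qReal_le (h := h) hB1 hγ x
  have hdM : d * (1 + 2 * ‖t‖) ≤ M := by
    have h1 : d * (1 + 2 * ‖t‖) ≤ d * (1 + 2 * π) := by gcongr
    have h0 : 0 ≤ (d : ℝ) * π ^ 2 := by positivity
    rw [hM, cellBound]; linarith
  set q := qC d h (complexPoint t γ)
  set Q := qC d h (complexPoint x γ)
  set n := qReal h t
  set N := qReal h x
  have hQ0 : 0 < ‖Q‖ := by nlinarith
  have hN0 : 0 < N := by nlinarith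
  have hnormn : ‖(n : ℂ)‖ = n := by rw [Complex.norm_real, Real.norm_of_nonneg hNt0]
  have hnormN : ‖(N : ℂ)‖ = N := by rw [Complex.norm_real, Real.norm_of_nonneg hN0.le]
  have hQinv : ‖Q‖⁻¹ ≤ 2 * r⁻¹ ^ 2 := by
    rw [inv_pow, ← div_eq_mul_inv, inv_le_comm₀ hQ0 (by positivity), inv_div]
    linarith
  have hNinv : N⁻¹ ≤ r⁻¹ ^ 2 := by
    rw [inv_pow]
    exact inv_anti₀ hr2 (by linarith)
  have hMd : M ≤ d * M := by nlinarith
  have hri : 0 ≤ r⁻¹ ^ 2 := by positivity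
  refine ⟨?_, ?_, ?_⟩
  · rw [norm_div, div_eq_mul_inv]
    calc ‖q‖ * ‖Q‖⁻¹ ≤ M * (2 * r⁻¹ ^ 2) := by gcongr
      _ ≤ 8 * d * M * r⁻¹ ^ 2 := by nlinarith
  · rw [norm_div, div_eq_mul_inv, hnormn, hnormN]
    calc n * N⁻¹ ≤ M * r⁻¹ ^ 2 := by gcongr
      _ ≤ 8 * d * M * r⁻¹ ^ 2 := by nlinarith
  · have hQne : Q ≠ 0 := norm_pos_iff.1 hQ0
    have hNne : (N : ℂ) ≠ 0 := by exact_mod_cast hN0.ne'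
    have hid : q / Q - (n : ℂ) / N = (q - n) * Q⁻¹ - n * (N : ℂ)⁻¹ * ((Q - N) * Q⁻¹) := by
      field_simp
      ring
    have hδx' : ‖Q - N‖ * ‖Q‖⁻¹ ≤ d * B * 6 := by
      rw [← div_eq_mul_inv, div_le_iff₀ hQ0]
      calc ‖Q - N‖ ≤ d * B * (1 + 2 * ‖x‖) := hδx
        _ ≤ d * B * (3 * ‖x‖ ^ 2) := by gcongr; nlinarith
        _ = d * B * 6 * (‖x‖ ^ 2 / 2) := by ring
        _ ≤ d * B * 6 * ‖Q‖ := by gcongr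
    have hδt' : ‖q - n‖ ≤ B * M := by nlinarith
    rw [hid]
    calc ‖(q - n) * Q⁻¹ - n * (N : ℂ)⁻¹ * ((Q - N) * Q⁻¹)‖
        ≤ ‖q - n‖ * ‖Q‖⁻¹ + n * N⁻¹ * (‖Q - N‖ * ‖Q‖⁻¹) := by
          refine (norm_sub_le _ _).trans (le_of_eq ?_)
          simp only [norm_mul, norm_inv, hnormn, hnormN]
      _ ≤ B * M * (2 * r⁻¹ ^ 2) + M * r⁻¹ ^ 2 * (d * B * 6) := by gcongr
      _ = B * (2 * M + 6 * (d * M)) * r⁻¹ ^ 2 := by ring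
      _ ≤ B * (2 * (d * M) + 6 * (d * M)) * r⁻¹ ^ 2 := by gcongr
      _ = B * (8 * d * M * r⁻¹ ^ 2) := by ring

/-- The periodized series `S_h(t + iγ)`. -/
def periodization {d : ℕ} (m : ℕ) (h : ℝ) (γ t : Fin d → ℝ) : ℂ :=
  ∑' k : Fin d → ℤ, (qC d h (complexPoint (latticeShift t k) γ) ^ m)⁻¹

lemma periodization_latticeShift {d m : ℕ} (h : ℝ) (γ t : Fin d → ℝ) (n : Fin d → ℤ) :
    periodization m h γ (latticeShift t n) = periodization m h γ t := by
  unfold periodization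
  simp only [latticeShift_latticeShift]
  exact (Equiv.addLeft n).tsum_eq
    (fun k => (qC d h (complexPoint (latticeShift t k) γ) ^ m)⁻¹)

lemma periodization_lower_bound_of_cell {d m : ℕ} {h B : ℝ} {γ t : Fin d → ℝ} (hd : 1 ≤ d)
    (hm : d < 2 * m) (hh : h ∈ Set.Icc (0 : ℝ) 1) (hB0 : 0 ≤ B) (hB1 : B ≤ 1)
    (hB : 6 * d * B ≤ 1)
    (hBm : 2 * (m * B * ((8 * d * cellBound d) ^ m * ∑' k : Fin d → ℤ, ‖k‖⁻¹ ^ (2 * m))) ≤ 1)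
    (hγ : ∀ p, |γ p| ≤ B) (ht : ‖t‖ ≤ π) (hq : qC d h (complexPoint t γ) ≠ 0) :
    Summable (fun k : Fin d → ℤ => ‖(qC d h (complexPoint (latticeShift t k) γ) ^ m)⁻¹‖) ∧
      1 / 2 ≤ ‖qC d h (complexPoint t γ)‖ ^ m * ‖periodization m h γ t‖ := by
  set R := 8 * d * cellBound d with hR
  have hsum := summable_norm_inv_pow_intVec hm
  set q := qC d h (complexPoint t γ) with hqdef
  let a : (Fin d → ℤ) → ℂ := fun k => q / qC d h (complexPoint (latticeShift t k) γ)
  have ha0 : a 0 = 1 := by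
    simp only [a, latticeShift_zero]
    exact div_self hq
  have hpow : ∀ k : Fin d → ℤ, (R * ‖k‖⁻¹ ^ 2) ^ m = R ^ m * ‖k‖⁻¹ ^ (2 * m) := fun k => by
    rw [mul_pow, ← pow_mul]
  have hk : ∀ k, k ≠ 0 → ‖a k ^ m‖ ≤ R ^ m * ‖k‖⁻¹ ^ (2 * m) ∧
      -(m * B * (R ^ m * ‖k‖⁻¹ ^ (2 * m))) ≤ (a k ^ m).re := fun k hk => by
    obtain ⟨h1, h2⟩ := norm_le_norm_latticeShift ht hk
    obtain ⟨b1, b2, b3⟩ := ratio_bounds hd hh hB0 hB1 hB hγ ht h1 h2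
    rw [← hpow]
    refine ⟨?_, ?_⟩
    · rw [norm_pow]
      exact pow_le_pow_left₀ (norm_nonneg _) b1 m
    · have h3 := norm_pow_sub_pow_le_of_norm_le b1 b2 b3 m
      have h4 := (abs_le.1 ((Complex.abs_re_le_norm _).trans h3)).1
      rw [Complex.sub_re, ← Complex.ofReal_div, ← Complex.ofReal_pow, Complex.ofReal_re] at h4
      have h5 : 0 ≤ (qReal h t / qReal h (latticeShift t k)) ^ m :=
        pow_nonneg (div_nonneg (qReal_nonneg _ _) (qReal_nonneg _ _)) _
      linarith
  have hsa : Summable fun k => ‖a k ^ m‖ := by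
    refine Summable.of_norm_bounded_eventually (hsum.mul_left (R ^ m)) ?_
    filter_upwards [(Set.finite_singleton (0 : Fin d → ℤ)).compl_mem_cofinite] with k hk0
    rw [norm_norm]
    exact (hk k hk0).1
  have hak : ∀ k, a k ^ m = q ^ m * (qC d h (complexPoint (latticeShift t k) γ) ^ m)⁻¹ :=
    fun k => by rw [div_pow, div_eq_mul_inv]
  refine ⟨?_, ?_⟩
  · refine (hsa.mul_left (‖q ^ m‖⁻¹)).congr fun k => ?_
    rw [hak, norm_mul, inv_mul_cancel_left₀ (norm_ne_zero_iff.2 (pow_ne_zero m hq))]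
  · have h1 : q ^ m * periodization m h γ t = ∑' k, a k ^ m := by
      simp only [hak]
      exact tsum_mul_left.symm
    rw [← norm_pow, ← norm_mul, h1]
    refine le_trans ?_ (Complex.re_le_norm _)
    have hsac : Summable fun k => a k ^ m := hsa.of_norm
    rw [Complex.re_tsum hsac]
    have hsingle : HasSum (Pi.single (0 : Fin d → ℤ) (1 : ℝ)) 1 := hasSum_pi_single 0 1
    have hlow := hsingle.sub ((hsum.mul_left (R ^ m)).mul_left (m * B)).hasSum
    refine le_trans ?_ (hasSum_le (fun k => ?_) hlow (Complex.hasSum_re hsac.hasSum).summable.hasSum)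
    · rw [tsum_mul_left, tsum_mul_left]
      linarith
    · by_cases hk0 : k = 0
      · subst hk0
        have : 2 * m ≠ 0 := by omega
        simp [ha0, this]
      · simpa [hk0] using (hk k hk0).2

lemma periodization_bounds {d m : ℕ} {h B : ℝ} {γ t : Fin d → ℝ} (hd : 1 ≤ d)
    (hm : d < 2 * m) (hh : h ∈ Set.Icc (0 : ℝ) 1) (hB0 : 0 ≤ B) (hB1 : B ≤ 1)
    (hB : 6 * d * B ≤ 1)
    (hBm : 2 * (m * B * ((8 * d * cellBound d) ^ m * ∑' k : Fin d → ℤ, ‖k‖⁻¹ ^ (2 * m))) ≤ 1)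
    (hγ : ∀ p, |γ p| ≤ B)
    (hq : ∀ k, qC d h (complexPoint (latticeShift t k) γ) ≠ 0) :
    Summable (fun k : Fin d → ℤ => ‖(qC d h (complexPoint (latticeShift t k) γ) ^ m)⁻¹‖) ∧
      periodization m h γ t ≠ 0 ∧
      ‖periodization m h γ t‖⁻¹ * (‖qC d h (complexPoint t γ)‖ ^ m)⁻¹ ≤
        2 * (25 * cellBound d) ^ m * (1 + ‖t‖) ^ (-(2 * m : ℝ)) := by
  have hM := one_le_cellBound d
  have hq0 : qC d h (complexPoint t γ) ≠ 0 := by simpa [latticeShift_zero] using hq 0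
  have hweight : (1 + ‖t‖) ^ (-(2 * m : ℝ)) = (((1 + ‖t‖) ^ 2) ^ m)⁻¹ := by
    rw [rpow_neg (by positivity), ← pow_mul]
    congr 1
    exact_mod_cast rpow_natCast (1 + ‖t‖) (2 * m)
  obtain ⟨n, hn⟩ := exists_latticeShift_norm_le t
  obtain ⟨h1, h2⟩ :=
    periodization_lower_bound_of_cell hd hm hh hB0 hB1 hB hBm hγ hn (hq n)
  rw [periodization_latticeShift] at h2
  simp only [latticeShift_latticeShift] at h1
  have hS : 0 < ‖periodization m h γ t‖ := by
    by_contra hS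
    rw [le_antisymm (not_lt.1 hS) (norm_nonneg _), mul_zero] at h2
    norm_num at h2
  refine ⟨(Equiv.addLeft n).summable_iff.1 h1, norm_pos_iff.1 hS, ?_⟩
  rw [hweight]
  by_cases ht : ‖t‖ ≤ π
  · have h3 := (periodization_lower_bound_of_cell hd hm hh hB0 hB1 hB hBm hγ ht hq0).2
    have h4 : (1 + ‖t‖) ^ 2 ≤ 25 * cellBound d := by
      nlinarith [pi_lt_four, norm_nonneg t]
    calc ‖periodization m h γ t‖⁻¹ * (‖qC d h (complexPoint t γ)‖ ^ m)⁻¹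
        = (‖qC d h (complexPoint t γ)‖ ^ m * ‖periodization m h γ t‖)⁻¹ := by
          rw [mul_inv, mul_comm]
      _ ≤ (1 / 2)⁻¹ := inv_anti₀ (by norm_num) h3
      _ = 2 * 1 := by norm_num
      _ ≤ 2 * ((25 * cellBound d) ^ m * (((1 + ‖t‖) ^ 2) ^ m)⁻¹) := by
          gcongr
          rw [← div_eq_mul_inv, one_le_div (by positivity)]
          gcongr
      _ = _ := by ring
  · have ht1 : 1 ≤ ‖t‖ := by linarith [pi_gt_three]
    have h3 := half_sq_norm_le_norm_qC (h := h) hd hB1 hB hγ ht1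
    have h4 : (1 + ‖t‖) ^ 2 / 8 ≤ ‖qC d h (complexPoint t γ)‖ := by nlinarith
    have h5 := norm_qC_le_cellBound hh hB1 hγ hn
    have h6 : ‖periodization m h γ t‖⁻¹ ≤ 2 * cellBound d ^ m := by
      rw [inv_le_iff_one_le_mul₀ hS]
      have : ‖qC d h (complexPoint (latticeShift t n) γ)‖ ^ m * ‖periodization m h γ t‖ ≤
          cellBound d ^ m * ‖periodization m h γ t‖ := by gcongr
      linarith
    calc ‖periodization m h γ t‖⁻¹ * (‖qC d h (complexPoint t γ)‖ ^ m)⁻¹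
        ≤ 2 * cellBound d ^ m * (((1 + ‖t‖) ^ 2 / 8) ^ m)⁻¹ := by gcongr
      _ = 2 * (8 * cellBound d) ^ m * (((1 + ‖t‖) ^ 2) ^ m)⁻¹ := by
          rw [div_pow, inv_div, mul_pow]
          ring
      _ ≤ 2 * (25 * cellBound d) ^ m * (((1 + ‖t‖) ^ 2) ^ m)⁻¹ := by
          gcongr
          norm_num

lemma qC_complexPoint_im {d : ℕ} (h : ℝ) (x γ : Fin d → ℝ) :
    (qC d h (complexPoint x γ)).im = 2 * ∑ p, γ p * x p := by
  have : ((h : ℂ) ^ 2).im = 0 := by rw [← Complex.ofReal_pow, Complex.ofReal_im]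
  simp only [qC, complexPoint, Complex.add_im, Complex.im_sum, this, add_zero, Finset.mul_sum]
  refine Finset.sum_congr rfl fun p _ => ?_
  simp [pow_two]
  ring

lemma ae_qC_latticeShift_ne_zero {d : ℕ} (h : ℝ) {γ : Fin d → ℝ} (hγ : γ ≠ 0) :
    ∀ᵐ t : Fin d → ℝ, ∀ k, qC d h (complexPoint (latticeShift t k) γ) ≠ 0 := by
  rw [ae_all_iff]
  intro k
  let V : Submodule ℝ (Fin d → ℝ) := LinearMap.ker (Fintype.linearCombination ℝ γ)
  have hV : V ≠ ⊤ := by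
    obtain ⟨p, hp⟩ := Function.ne_iff.1 hγ
    intro hV
    have : Pi.single p (1 : ℝ) ∈ V := hV ▸ Submodule.mem_top
    simp [V, Fintype.linearCombination_apply_single] at this
    exact hp this
  have h0 : ∀ᵐ x : Fin d → ℝ, x ∉ (V : Set (Fin d → ℝ)) :=
    measure_eq_zero_iff_ae_notMem.1 (Measure.addHaar_submodule volume V hV)
  have h1 := (measurePreserving_add_right (volume : Measure (Fin d → ℝ))
    (fun p => 2 * π * (k p : ℝ))).quasiMeasurePreserving.ae h0
  filter_upwards [h1] with t ht hzero
  refine ht ?_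
  have him := qC_complexPoint_im h (latticeShift t k) γ
  rw [hzero, Complex.zero_im] at him
  simp only [V, SetLike.mem_coe, LinearMap.mem_ker, Fintype.linearCombination_apply, smul_eq_mul]
  simp only [latticeShift] at him
  simp only [Pi.add_apply, mul_comm _ (γ _)]
  linarith

lemma measurable_qC_complexPoint {d : ℕ} (h : ℝ) (γ : Fin d → ℝ) :
    Measurable fun x : Fin d → ℝ => qC d h (complexPoint x γ) := by
  unfold qC complexPoint
  fun_prop

lemma measurable_periodization {d : ℕ} (m : ℕ) (h : ℝ) (γ : Fin d → ℝ) :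
    Measurable (periodization m h γ) := by
  unfold periodization
  refine Measurable.tsum fun k => ?_
  have : Measurable fun t : Fin d → ℝ => latticeShift t k := by
    unfold latticeShift
    fun_prop
  exact (((measurable_qC_complexPoint h γ).comp this).pow_const m).inv

/-- Let `2m > d`. There is `α > 0`, depending only on `d` and `m`, such that for every
`B ∈ (0,α)` there is `C > 0` with: for every `h ∈ [0,1]` and every `γ ∈ {-B,B}^d`,
for almost every `t ∈ ℝ^d` the series `S_h(t+iγ) = Σ_k q_h(t+iγ+2πk)^{-m}` converges
absolutely and is nonzero, and `∫ |S_h(t+iγ)|⁻¹ |q_h(t+iγ)|^{-m} dt ≤ C` (the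
integrand being integrable). -/
theorem stmt_11 (d m : ℕ) (hd : 1 ≤ d) (hm : d < 2 * m) :
    ∃ α : ℝ, 0 < α ∧
      ∀ B : ℝ, 0 < B → B < α → ∃ C : ℝ, 0 < C ∧
        ∀ h ∈ Set.Icc (0 : ℝ) 1, ∀ γ : Fin d → ℝ, (∀ p, γ p = B ∨ γ p = -B) →
          (∀ᵐ t : Fin d → ℝ ∂volume,
            Summable (fun k : Fin d → ℤ =>
              ‖((qC d h (fun p => (t p : ℂ) + Complex.I * (γ p : ℂ) +
                  2 * (π : ℂ) * (k p : ℂ))) ^ m)⁻¹‖) ∧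
            (∑' k : Fin d → ℤ,
              ((qC d h (fun p => (t p : ℂ) + Complex.I * (γ p : ℂ) +
                  2 * (π : ℂ) * (k p : ℂ))) ^ m)⁻¹) ≠ 0) ∧
          Integrable (fun t : Fin d → ℝ =>
            ‖∑' k : Fin d → ℤ,
                ((qC d h (fun p => (t p : ℂ) + Complex.I * (γ p : ℂ) +
                    2 * (π : ℂ) * (k p : ℂ))) ^ m)⁻¹‖⁻¹ *
              (‖qC d h (fun p => (t p : ℂ) + Complex.I * (γ p : ℂ))‖ ^ m)⁻¹) ∧
          (∫ t : Fin d → ℝ,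
            ‖∑' k : Fin d → ℤ,
                ((qC d h (fun p => (t p : ℂ) + Complex.I * (γ p : ℂ) +
                    2 * (π : ℂ) * (k p : ℂ))) ^ m)⁻¹‖⁻¹ *
              (‖qC d h (fun p => (t p : ℂ) + Complex.I * (γ p : ℂ))‖ ^ m)⁻¹) ≤ C := by
  simp only [← complexPoint_latticeShift]
  change ∃ α : ℝ, 0 < α ∧
      ∀ B : ℝ, 0 < B → B < α → ∃ C : ℝ, 0 < C ∧
        ∀ h ∈ Set.Icc (0 : ℝ) 1, ∀ γ : Fin d → ℝ, (∀ p, γ p = B ∨ γ p = -B) →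
          (∀ᵐ t : Fin d → ℝ ∂volume,
            Summable (fun k : Fin d → ℤ =>
              ‖((qC d h (complexPoint (latticeShift t k) γ)) ^ m)⁻¹‖) ∧
            periodization m h γ t ≠ 0) ∧
          Integrable (fun t : Fin d → ℝ =>
            ‖periodization m h γ t‖⁻¹ * (‖qC d h (complexPoint t γ)‖ ^ m)⁻¹) ∧
          (∫ t : Fin d → ℝ,
            ‖periodization m h γ t‖⁻¹ * (‖qC d h (complexPoint t γ)‖ ^ m)⁻¹) ≤ C
  let W : ℝ := m * ((8 * d * cellBound d) ^ m * ∑' k : Fin d → ℤ, ‖k‖⁻¹ ^ (2 * m))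
  have hM := one_le_cellBound d
  have hW : 0 ≤ W := by
    have : 0 ≤ ∑' k : Fin d → ℤ, ‖k‖⁻¹ ^ (2 * m) := tsum_nonneg fun k => by positivity
    positivity
  let g : (Fin d → ℝ) → ℝ := fun t =>
    2 * (25 * cellBound d) ^ m * (1 + ‖t‖) ^ (-(2 * m : ℝ))
  have hg : Integrable g := by
    refine (integrable_one_add_norm ?_).const_mul _
    rw [Module.finrank_fin_fun]
    exact_mod_cast hm
  have hg0 : 0 ≤ ∫ t, g t := integral_nonneg fun t => by positivity
  refine ⟨1 / (1 + 6 * d + 2 * W), by positivity, fun B hB0 hBα => ?_⟩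
  rw [lt_div_iff₀ (by positivity)] at hBα
  have hBd : 0 ≤ B * (6 * d) := by positivity
  have hBW : 0 ≤ B * (2 * W) := by positivity
  have hB1 : B ≤ 1 := by linarith
  have hB : 6 * d * B ≤ 1 := by linarith
  have hBm : 2 * (m * B * ((8 * d * cellBound d) ^ m *
      ∑' k : Fin d → ℤ, ‖k‖⁻¹ ^ (2 * m))) ≤ 1 := by
    have : B * (2 * W) ≤ 1 := by linarith
    refine le_trans (le_of_eq ?_) this
    simp only [W]
    ring
  refine ⟨(∫ t, g t) + 1, by linarith, fun h hh γ hγ => ?_⟩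
  have hγB : ∀ p, |γ p| ≤ B := fun p => by
    rcases hγ p with hp | hp <;> simp [hp, abs_of_pos hB0]
  have hγ0 : γ ≠ 0 := fun h0 => by
    have := hγ ⟨0, hd⟩
    simp [h0] at this
    rcases this with hp | hp <;> linarith
  have hmain := (ae_qC_latticeShift_ne_zero h hγ0).mono fun t hq =>
    periodization_bounds hd hm hh hB0.le hB1 hB hBm hγB hq
  have hle : ∀ᵐ t : Fin d → ℝ,
      ‖periodization m h γ t‖⁻¹ * (‖qC d h (complexPoint t γ)‖ ^ m)⁻¹ ≤ g t :=
    hmain.mono fun t ht => ht.2.2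
  have hmeas : AEStronglyMeasurable (fun t : Fin d → ℝ =>
      ‖periodization m h γ t‖⁻¹ * (‖qC d h (complexPoint t γ)‖ ^ m)⁻¹) :=
    ((measurable_periodization m h γ).norm.inv.mul
      ((measurable_qC_complexPoint h γ).norm.pow_const m).inv).aestronglyMeasurable
  have hint : Integrable (fun t : Fin d → ℝ =>
      ‖periodization m h γ t‖⁻¹ * (‖qC d h (complexPoint t γ)‖ ^ m)⁻¹) := by
    refine hg.mono' hmeas (hle.mono fun t ht => ?_)
    rwa [Real.norm_of_nonneg (by positivity)]
  exact ⟨hmain.mono fun t ht => ⟨ht.1, ht.2.1⟩, hint,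
    (integral_mono_ae hint hg hle).trans (by linarith)⟩
end
end
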